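/- Let N ≥ 1 and κ > 0 be real numbers, and for ρ > 0 set V_{κ,N}(ρ) = ∫₀^ρ sinh(κs)^{N−1} ds. Then for all real numbers 0 < r < R, one has V_{κ,N}(R) ≤ e^{(N−1)·κ²·R²/4} · (R/r)^N · V_{κ,N}(r). -/

import Mathlib

open MeasureTheory

theorem sinh_le_mul_cosh {u : ℝ} (hu : 0 ≤ u) : Real.sinh u ≤ u * Real.cosh u := by
  have hder (x : ℝ) :
      HasDerivAt (fun x => x * Real.cosh x - Real.sinh x) (x * Real.sinh x) x :=
    (((hasDerivAt_id' x).mul (Real.hasDerivAt_cosh x)).sub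
      (Real.hasDerivAt_sinh x)).congr_deriv (by ring)
  have hmono : MonotoneOn (fun x => x * Real.cosh x - Real.sinh x) (Set.Ici 0) := by
    refine monotoneOn_of_deriv_nonneg (convex_Ici 0)
      (fun x _ => (hder x).continuousAt.continuousWithinAt)
      (fun x _ => (hder x).differentiableAt.differentiableWithinAt) fun x hx => ?_
    rw [interior_Ici, Set.mem_Ioi] at hx
    rw [(hder x).deriv]
    exact mul_nonneg hx.le (Real.sinh_nonneg_iff.2 hx.le)
  simpa using hmono Set.self_mem_Ici hu hu

theorem sinh_le_mul_exp_sq_div_four {y : ℝ} (hy : 0 ≤ y) :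
    Real.sinh y ≤ y * Real.exp (y ^ 2 / 4) := by
  have hsq : Real.cosh (y / 2) ^ 2 ≤ Real.exp (y ^ 2 / 4) := by
    calc Real.cosh (y / 2) ^ 2 ≤ Real.exp ((y / 2) ^ 2 / 2) ^ 2 := by
          gcongr
          exact Real.cosh_le_exp_half_sq _
      _ = Real.exp (y ^ 2 / 4) := by
          rw [← Real.exp_nat_mul]
          congr 1
          push_cast
          ring
  calc Real.sinh y = 2 * Real.sinh (y / 2) * Real.cosh (y / 2) := by
        rw [← Real.sinh_two_mul]
        congr 1
        ring
    _ ≤ 2 * (y / 2 * Real.cosh (y / 2)) * Real.cosh (y / 2) := by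
        gcongr
        exact sinh_le_mul_cosh (by positivity)
    _ = y * Real.cosh (y / 2) ^ 2 := by ring
    _ ≤ y * Real.exp (y ^ 2 / 4) := by gcongr

theorem continuous_sinh_mul_rpow {N : ℝ} (hN : 1 ≤ N) (κ : ℝ) :
    Continuous fun s => Real.sinh (κ * s) ^ (N - 1) :=
  (Real.continuous_sinh.comp (continuous_const_mul κ)).rpow_const
    fun _ => Or.inr (sub_nonneg.2 hN)

theorem sinh_mul_rpow_le {N κ c R t : ℝ} (hN : 1 ≤ N) (hκ : 0 ≤ κ) (hc : 0 ≤ c) (ht : 0 ≤ t)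
    (hct : c * t ≤ R) :
    Real.sinh (κ * (c * t)) ^ (N - 1) ≤
      Real.exp ((N - 1) * κ ^ 2 * R ^ 2 / 4) * c ^ (N - 1) * Real.sinh (κ * t) ^ (N - 1) := by
  have hs : 0 ≤ Real.sinh (κ * t) := Real.sinh_nonneg_iff.2 (by positivity)
  have hbase : Real.sinh (κ * (c * t)) ≤
      Real.exp (κ ^ 2 * R ^ 2 / 4) * c * Real.sinh (κ * t) := by
    calc Real.sinh (κ * (c * t))
        ≤ κ * (c * t) * Real.exp ((κ * (c * t)) ^ 2 / 4) :=
          sinh_le_mul_exp_sq_div_four (by positivity)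
      _ ≤ κ * (c * t) * Real.exp ((κ * R) ^ 2 / 4) := by gcongr
      _ = Real.exp (κ ^ 2 * R ^ 2 / 4) * c * (κ * t) := by rw [mul_pow]; ring
      _ ≤ Real.exp (κ ^ 2 * R ^ 2 / 4) * c * Real.sinh (κ * t) := by
          gcongr
          exact Real.self_le_sinh_iff.2 (by positivity)
  calc Real.sinh (κ * (c * t)) ^ (N - 1)
      ≤ (Real.exp (κ ^ 2 * R ^ 2 / 4) * c * Real.sinh (κ * t)) ^ (N - 1) :=
        Real.rpow_le_rpow (Real.sinh_nonneg_iff.2 (by positivity)) hbase (sub_nonneg.2 hN)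
    _ = _ := by
        rw [Real.mul_rpow (by positivity) hs, Real.mul_rpow (by positivity) hc, ← Real.exp_mul]
        congr 3
        ring

/-- The quantitative Bishop–Gromov bound (2.8) for the model volume function
`V_{κ,N}(ρ) = ∫₀^ρ sinh(κs)^{N−1} ds`, with `C̄(N) = (N−1)/4`:
`V_{κ,N}(R) ≤ e^{(N−1)κ²R²/4} (R/r)^N V_{κ,N}(r)` for `0 < r < R`. -/
theorem model_volume_ratio_bound (N κ : ℝ) (hN : 1 ≤ N) (hκ : 0 < κ)
    (r R : ℝ) (hr : 0 < r) (hrR : r < R) :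
    (∫ s in Set.Ioo (0 : ℝ) R, Real.sinh (κ * s) ^ (N - 1))
      ≤ Real.exp ((N - 1) * κ ^ 2 * R ^ 2 / 4) * (R / r) ^ N
          * ∫ s in Set.Ioo (0 : ℝ) r, Real.sinh (κ * s) ^ (N - 1) := by
  have hR : 0 < R := hr.trans hrR
  have hc : 0 < R / r := div_pos hR hr
  have hcont := continuous_sinh_mul_rpow hN κ
  rw [← integral_Ioc_eq_integral_Ioo, ← integral_Ioc_eq_integral_Ioo,
    ← intervalIntegral.integral_of_le hR.le, ← intervalIntegral.integral_of_le hr.le]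
  calc ∫ s in (0 : ℝ)..R, Real.sinh (κ * s) ^ (N - 1)
      = R / r * ∫ t in (0 : ℝ)..r, Real.sinh (κ * (R / r * t)) ^ (N - 1) := by
        rw [intervalIntegral.mul_integral_comp_mul_left
          (f := fun s => Real.sinh (κ * s) ^ (N - 1)), mul_zero, div_mul_cancel₀ _ hr.ne']
    _ ≤ R / r * ∫ t in (0 : ℝ)..r, Real.exp ((N - 1) * κ ^ 2 * R ^ 2 / 4) *
          (R / r) ^ (N - 1) * Real.sinh (κ * t) ^ (N - 1) := by
        refine mul_le_mul_of_nonneg_left ?_ hc.le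
        refine intervalIntegral.integral_mono_on hr.le
          ((hcont.comp (continuous_const_mul (R / r))).intervalIntegrable _ _)
          ((hcont.const_mul _).intervalIntegrable _ _) fun t ht => ?_
        refine sinh_mul_rpow_le hN hκ.le hc.le ht.1 ?_
        calc R / r * t ≤ R / r * r := by gcongr; exact ht.2
          _ = R := div_mul_cancel₀ _ hr.ne'
    _ = _ := by
        rw [intervalIntegral.integral_const_mul, Real.rpow_sub_one hc.ne']
        field_simp
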